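/- Let q be an odd prime power and Z ⊆ F_q^2 a finite set. The number W of quadruples (v,w,x,y) ∈ Z^4 satisfying v + w = x + y and v·w = x·y is at most 2·(#Z)^2·q, where a·b denotes the standard inner product on F_q^2. (Indeed, for fixed v, w ∈ Z and a fixed first coordinate of x, the relation v·w = x·(v + w − x) is a nontrivial quadratic equation for the second coordinate of x, hence has at most 2 solutions.) -/

import Mathlib

open Finset

/-- Standard inner product on `F²`. -/
def dotp {F : Type*} [Field F] (a b : Fin 2 → F) : F :=
  ∑ i, a i * b i

/-- For `Z ⊆ F_q²`, the number of quadruples `(v,w,x,y) ∈ Z⁴` with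
`v + w = x + y` and `v·w = x·y` is at most `2·(#Z)²·q`. -/
theorem card_quadruples_le {F : Type*} [Field F] [Fintype F]
    [DecidableEq F] (hq : Odd (Fintype.card F)) (Z : Finset (Fin 2 → F)) :
    (((Z ×ˢ Z) ×ˢ (Z ×ˢ Z)).filter fun p =>
        p.1.1 + p.1.2 = p.2.1 + p.2.2 ∧ dotp p.1.1 p.1.2 = dotp p.2.1 p.2.2).card ≤
      2 * Z.card ^ 2 * Fintype.card F := by
  have maps_to : ∀ p ∈ ((Z ×ˢ Z) ×ˢ (Z ×ˢ Z)).filter fun p =>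
      p.1.1 + p.1.2 = p.2.1 + p.2.2 ∧ dotp p.1.1 p.1.2 = dotp p.2.1 p.2.2,
      (p.1, p.2.1 0) ∈ (Z ×ˢ Z) ×ˢ (univ : Finset F) := by
    intro p hp
    simp only [mem_filter, mem_product] at hp
    simpa using hp.1.1
  refine (card_le_mul_card_image_of_maps_to maps_to 2 ?_).trans_eq (by
    rw [card_product, card_product, card_univ]; ring)
  intro b _
  obtain he | ⟨p, hp⟩ := Finset.eq_empty_or_nonempty ((((Z ×ˢ Z) ×ˢ (Z ×ˢ Z)).filter fun p =>
      p.1.1 + p.1.2 = p.2.1 + p.2.2 ∧ dotp p.1.1 p.1.2 = dotp p.2.1 p.2.2).filter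
        fun p => (p.1, p.2.1 0) = b)
  · rw [he]; simp
  refine (card_le_card (t := {p, (p.1, (![p.2.1 0, p.2.2 1], ![p.2.2 0, p.2.1 1]))}) ?_).trans
    card_le_two
  intro r hr
  obtain ⟨⟨v, w⟩, x, y⟩ := p
  obtain ⟨⟨v', w'⟩, x', y'⟩ := r
  simp only [mem_filter, mem_product] at hp hr
  obtain ⟨⟨_, hadd, hdot⟩, rfl⟩ := hp
  obtain ⟨⟨_, hadd', hdot'⟩, heq⟩ := hr
  simp only [Prod.mk.injEq] at heq
  obtain ⟨⟨rfl, rfl⟩, hx0⟩ := heq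
  have hsum := hadd.symm.trans hadd'
  have hprod := hdot.symm.trans hdot'
  have h0 : x 0 + y 0 = x' 0 + y' 0 := congrFun hsum 0
  have h1 : x 1 + y 1 = x' 1 + y' 1 := congrFun hsum 1
  simp only [dotp, Fin.sum_univ_two] at hprod
  have hy0 : y' 0 = y 0 := by linear_combination -h0 - hx0
  have hfac : (x' 1 - x 1) * (x' 1 - y 1) = 0 := by
    rw [hx0, hy0] at hprod
    linear_combination hprod - x' 1 * h1
  simp only [mem_insert, mem_singleton, Prod.mk.injEq, true_and, funext_iff, Fin.forall_fin_two,
    Matrix.cons_val_zero, Matrix.cons_val_one]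
  rcases mul_eq_zero.mp hfac with h | h
  · exact Or.inl ⟨⟨hx0, sub_eq_zero.mp h⟩, hy0, by linear_combination -h1 - h⟩
  · exact Or.inr ⟨⟨hx0, sub_eq_zero.mp h⟩, hy0, by linear_combination -h1 - h⟩
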